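/- Let B be a Banach space, 0 < T < ∞, 1 ≤ p < ∞, and let 𝓕 be a subset of L^p([0,T];B) (Bochner p-integrable functions from [0,T] to B). Then 𝓕 is relatively compact in L^p([0,T];B) if and only if the following two conditions hold: (i) for every 0 < t₁ < t₂ < T, the set { ∫_{t₁}^{t₂} f(t) dt : f ∈ 𝓕 } is relatively compact in B; (ii) ‖f(·+h) − f(·)‖_{L^p([0,T−h];B)} → 0 as h → 0⁺, uniformly for f ∈ 𝓕, i.e. sup_{f ∈ 𝓕} ‖f(·+h) − f(·)‖_{L^p([0,T−h];B)} → 0 as h → 0⁺. -/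

import Mathlib

open MeasureTheory
open scoped ENNReal

/-- Jensen's inequality for the distance from a point to the mean of a function. -/
lemma enorm_sub_integral_rpow_le {α B : Type*} [MeasurableSpace α] [NormedAddCommGroup B]
    [NormedSpace ℝ B] [CompleteSpace B] {μ : Measure α} [IsProbabilityMeasure μ] {f : α → B}
    (hf : Integrable f μ) (x : B) {q : ℝ} (hq : 1 ≤ q) :
    ‖x - ∫ s, f s ∂μ‖ₑ ^ q ≤ ∫⁻ s, ‖x - f s‖ₑ ^ q ∂μ := by
  have hq0 : 0 < q := by linarith
  have hmean : x - ∫ s, f s ∂μ = ∫ s, (x - f s) ∂μ := by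
    rw [integral_sub (integrable_const x) hf]
    simp
  have hpow := eLpNorm_le_eLpNorm_of_exponent_le (μ := μ) (f := fun s => x - f s) (p := 1)
    (q := ENNReal.ofReal q) (by simpa using ENNReal.ofReal_le_ofReal hq)
    (aestronglyMeasurable_const.sub hf.aestronglyMeasurable)
  rw [eLpNorm_one_eq_lintegral_enorm, eLpNorm_eq_lintegral_rpow_enorm_toReal
    (by simpa using hq0) ENNReal.ofReal_ne_top, ENNReal.toReal_ofReal hq0.le] at hpow
  rw [hmean]
  calc ‖∫ s, (x - f s) ∂μ‖ₑ ^ q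
      ≤ ((∫⁻ s, ‖x - f s‖ₑ ^ q ∂μ) ^ (1 / q)) ^ q :=
        ENNReal.rpow_le_rpow ((enorm_integral_le_lintegral_enorm _).trans hpow) hq0.le
    _ = ∫⁻ s, ‖x - f s‖ₑ ^ q ∂μ := by
        rw [← ENNReal.rpow_mul, one_div_mul_cancel hq0.ne', ENNReal.rpow_one]

/-- The `L^q` distance between `f` and its shift by `r`, of either sign, is controlled by the
forward shift by `|r|`. -/
lemma lintegral_shift_le {B : Type*} [NormedAddCommGroup B] {f : ℝ → B} {T h q : ℝ} {M : ℝ≥0∞}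
    (hq : 0 < q)
    (hM : ∀ r, 0 < r → r < h → ∫⁻ t in Set.Icc 0 (T - r), ‖f (t + r) - f t‖ₑ ^ q ≤ M)
    {r : ℝ} (hr : r ∈ Set.Ioo (-h) h) :
    ∫⁻ t in Set.Icc 0 T, (Set.Icc 0 T).indicator (fun s => ‖f t - f s‖ₑ ^ q) (t + r) ≤ M := by
  rw [← lintegral_indicator measurableSet_Icc]
  rcases lt_trichotomy r 0 with hr0 | rfl | hr0
  · rw [← lintegral_sub_right_eq_self _ r]
    refine le_trans ?_ (hM (-r) (by linarith) (by linarith [hr.1]))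
    rw [← lintegral_indicator measurableSet_Icc]
    refine lintegral_mono fun t => ?_
    simp only [Set.indicator, Set.mem_Icc, sub_add_cancel, ← sub_eq_add_neg]
    split_ifs <;> first | exact le_rfl | exact zero_le | (exfalso; grind)
  · refine le_of_eq_of_le ?_ zero_le
    simp [Set.indicator, hq]
  · refine le_trans ?_ (hM r hr0 hr.2)
    rw [← lintegral_indicator measurableSet_Icc]
    refine lintegral_mono fun t => ?_
    simp only [Set.indicator, Set.mem_Icc]
    rw [← enorm_neg, neg_sub]
    split_ifs <;> first | exact le_rfl | exact zero_le | (exfalso; grind)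

lemma lintegral_lintegral_local_le {B : Type*} [NormedAddCommGroup B] {f : ℝ → B}
    (hf : StronglyMeasurable f) {T h q : ℝ} {M : ℝ≥0∞} (hq : 0 < q)
    (hM : ∀ r, 0 < r → r < h → ∫⁻ t in Set.Icc 0 (T - r), ‖f (t + r) - f t‖ₑ ^ q ≤ M)
    {J : ℝ → Set ℝ} (hJ : ∀ t ∈ Set.Ico 0 T, J t ⊆ Set.Icc 0 T ∩ Set.Ioo (t - h) (t + h))
    (hJm : ∀ t, MeasurableSet (J t)) :
    ∫⁻ t in Set.Ico 0 T, ∫⁻ s in J t, ‖f t - f s‖ₑ ^ q ≤ ENNReal.ofReal (2 * h) * M := by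
  have hmeas : Measurable (Function.uncurry fun t r : ℝ =>
      (Set.Icc 0 T).indicator (fun s => ‖f t - f s‖ₑ ^ q) (t + r)) := by
    have : (Function.uncurry fun t r : ℝ =>
        (Set.Icc 0 T).indicator (fun s => ‖f t - f s‖ₑ ^ q) (t + r)) =
        {z : ℝ × ℝ | z.1 + z.2 ∈ Set.Icc 0 T}.indicator
          fun z => ‖f z.1 - f (z.1 + z.2)‖ₑ ^ q := by
      ext z
      simp [Function.uncurry, Set.indicator]
    rw [this]
    refine Measurable.indicator ?_ (measurableSet_Icc.preimage (by fun_prop))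
    exact ((hf.comp_measurable measurable_fst).sub
      (hf.comp_measurable (measurable_fst.add measurable_snd))).enorm.pow_const q
  calc ∫⁻ t in Set.Ico 0 T, ∫⁻ s in J t, ‖f t - f s‖ₑ ^ q
      ≤ ∫⁻ t in Set.Ico 0 T, ∫⁻ r in Set.Ioo (-h) h,
          (Set.Icc 0 T).indicator (fun s => ‖f t - f s‖ₑ ^ q) (t + r) := by
        refine setLIntegral_mono' measurableSet_Ico fun t ht => ?_
        rw [← lintegral_indicator (hJm t), ← lintegral_indicator measurableSet_Ioo,
          ← lintegral_add_left_eq_self _ t]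
        refine lintegral_mono fun r => ?_
        by_cases hr : t + r ∈ J t
        · have := hJ t ht hr
          have hr' : r ∈ Set.Ioo (-h) h := by
            constructor <;> linarith [this.2.1, this.2.2]
          simp [Set.indicator_of_mem hr, Set.indicator_of_mem hr', Set.indicator_of_mem this.1]
        · simp [Set.indicator_of_notMem hr]
    _ ≤ ∫⁻ t in Set.Icc 0 T, ∫⁻ r in Set.Ioo (-h) h,
          (Set.Icc 0 T).indicator (fun s => ‖f t - f s‖ₑ ^ q) (t + r) :=
        lintegral_mono_set Set.Ico_subset_Icc_self
    _ = ∫⁻ r in Set.Ioo (-h) h, ∫⁻ t in Set.Icc 0 T,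
          (Set.Icc 0 T).indicator (fun s => ‖f t - f s‖ₑ ^ q) (t + r) :=
        lintegral_lintegral_swap hmeas.aemeasurable
    _ ≤ ∫⁻ _ in Set.Ioo (-h) h, M :=
        setLIntegral_mono' measurableSet_Ioo fun r hr => lintegral_shift_le hq hM hr
    _ = ENNReal.ofReal (2 * h) * M := by
        rw [setLIntegral_const, Real.volume_Ioo, mul_comm]
        ring_nf

/-- The middle third of the `k`-th cell of the grid of mesh `h`. -/
def middleThird (h : ℝ) (k : ℕ) : Set ℝ := Set.Ioc (h * (k + 1 / 3)) (h * (k + 2 / 3))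

lemma volume_middleThird (h : ℝ) (k : ℕ) :
    volume (middleThird h k) = ENNReal.ofReal (h / 3) := by
  rw [middleThird, Real.volume_Ioc]
  ring_nf

lemma middleThird_subset {h : ℝ} (hh : 0 < h) {k N : ℕ} (hk : k < N) :
    middleThird h k ⊆ Set.Ioo 0 (h * N) := by
  intro s hs
  have hk' : (k : ℝ) + 1 ≤ N := by exact_mod_cast hk
  have h0 : (0 : ℝ) ≤ k := k.cast_nonneg
  constructor
  · exact lt_of_le_of_lt (by positivity) hs.1
  · exact hs.2.trans_lt (by nlinarith)

lemma floor_div_lt {h t : ℝ} (hh : 0 < h) {N : ℕ} (ht : t ∈ Set.Ico 0 (h * N)) :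
    ⌊t / h⌋₊ < N := by
  rw [Nat.floor_lt (div_nonneg ht.1 hh.le), div_lt_iff₀ hh, mul_comm]
  exact ht.2

/-- The step function that equals, on each cell of the grid of mesh `h`, the average of `f` over
the middle third of that cell. -/
noncomputable def stepAverage {B : Type*} [NormedAddCommGroup B] [NormedSpace ℝ B] (h : ℝ)
    (f : ℝ → B) (t : ℝ) : B :=
  ⨍ s in middleThird h ⌊t / h⌋₊, f s

lemma stronglyMeasurable_stepAverage {B : Type*} [NormedAddCommGroup B] [NormedSpace ℝ B] (h : ℝ)
    (f : ℝ → B) : StronglyMeasurable (stepAverage h f) :=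
  StronglyMeasurable.comp_measurable (g := fun t : ℝ => ⌊t / h⌋₊)
    (f := fun k => ⨍ s in middleThird h k, f s) .of_discrete
    (Nat.measurable_floor.comp (measurable_id.div_const h))

lemma eLpNorm_sub_stepAverage_le {B : Type*} [NormedAddCommGroup B] [NormedSpace ℝ B]
    [CompleteSpace B] {f : ℝ → B} (hf : StronglyMeasurable f) {h T : ℝ} (hh : 0 < h)
    {N : ℕ} (hT : h * N = T)
    (hfi : IntegrableOn f (Set.Icc 0 T)) {p : ℝ≥0∞} (hp1 : 1 ≤ p) (hp : p ≠ ⊤) {δ : ℝ≥0∞}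
    (hδ : ∀ r, 0 < r → r < h → eLpNorm (fun t => f (t + r) - f t) p
      (volume.restrict (Set.Icc 0 (T - r))) ≤ δ) :
    eLpNorm (f - stepAverage h f) p (volume.restrict (Set.Icc 0 T)) ≤ 6 * δ := by
  subst hT
  have hp0 : p ≠ 0 := (zero_lt_one.trans_le hp1).ne'
  have hq1 : 1 ≤ p.toReal := by simpa using ENNReal.toReal_mono hp hp1
  have hq : 0 < p.toReal := by linarith
  have hM : ∀ r, 0 < r → r < h → ∫⁻ t in Set.Icc 0 (h * N - r),
      ‖f (t + r) - f t‖ₑ ^ p.toReal ≤ δ ^ p.toReal := by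
    intro r hr0 hr
    have := hδ r hr0 hr
    rwa [eLpNorm_eq_lintegral_rpow_enorm_toReal hp0 hp, one_div,
      ENNReal.rpow_inv_le_iff hq] at this
  have hlocal := lintegral_lintegral_local_le hf hq hM
    (J := fun t => middleThird h ⌊t / h⌋₊) (fun t ht s hs => by
      refine ⟨Set.Ioo_subset_Icc_self (middleThird_subset hh (floor_div_lt hh ht) hs), ?_⟩
      have h1 := Nat.floor_le (div_nonneg ht.1 hh.le)
      have h2 := Nat.lt_floor_add_one (t / h)
      rw [le_div_iff₀ hh] at h1
      rw [div_lt_iff₀ hh] at h2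
      have h3 := hs.1
      have h4 := hs.2
      constructor <;> nlinarith) (fun t => measurableSet_Ioc)
  have hvol : ENNReal.ofReal (h / 3) ≠ 0 := by simpa using hh
  have hpt : ∀ t ∈ Set.Ico 0 (h * N), ‖(f - stepAverage h f) t‖ₑ ^ p.toReal ≤
      (ENNReal.ofReal (h / 3))⁻¹ *
        ∫⁻ s in middleThird h ⌊t / h⌋₊, ‖f t - f s‖ₑ ^ p.toReal := by
    intro t ht
    have hJ : volume (middleThird h ⌊t / h⌋₊) = _ := volume_middleThird h _
    set J := middleThird h ⌊t / h⌋₊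
    have : IsProbabilityMeasure (((volume.restrict J) Set.univ)⁻¹ • volume.restrict J) := by
      constructor
      simp only [Measure.restrict_apply_univ, hJ, Measure.smul_apply, smul_eq_mul]
      exact ENNReal.inv_mul_cancel hvol ENNReal.ofReal_ne_top
    have hint : Integrable f (((volume.restrict J) Set.univ)⁻¹ • volume.restrict J) := by
      refine Integrable.smul_measure (hfi.mono_set
        ((middleThird_subset hh (floor_div_lt hh ht)).trans Set.Ioo_subset_Icc_self)) ?_
      simpa [hJ] using hh
    have := enorm_sub_integral_rpow_le hint (f t) hq1
    rw [lintegral_smul_measure, smul_eq_mul] at this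
    rw [← hJ, ← Measure.restrict_apply_univ]
    exact this
  rw [eLpNorm_eq_lintegral_rpow_enorm_toReal hp0 hp, one_div, ENNReal.rpow_inv_le_iff hq,
    ← Measure.restrict_congr_set Ico_ae_eq_Icc]
  calc ∫⁻ t in Set.Ico 0 (h * N), ‖(f - stepAverage h f) t‖ₑ ^ p.toReal
      ≤ ∫⁻ t in Set.Ico 0 (h * N), (ENNReal.ofReal (h / 3))⁻¹ *
        ∫⁻ s in middleThird h ⌊t / h⌋₊, ‖f t - f s‖ₑ ^ p.toReal :=
        setLIntegral_mono' measurableSet_Ico hpt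
    _ ≤ (ENNReal.ofReal (h / 3))⁻¹ * (ENNReal.ofReal (2 * h) * δ ^ p.toReal) := by
        rw [lintegral_const_mul' _ _ (by simpa using hh)]
        gcongr
    _ = 6 * δ ^ p.toReal := by
        rw [← mul_assoc, show 2 * h = 6 * (h / 3) by ring, ENNReal.ofReal_mul (by norm_num),
          mul_left_comm, ENNReal.inv_mul_cancel hvol ENNReal.ofReal_ne_top]
        simp
    _ ≤ (6 * δ) ^ p.toReal := by
        rw [ENNReal.mul_rpow_of_nonneg _ _ hq.le]
        gcongr
        exact ENNReal.le_rpow_self_of_one_le (by norm_num) hq1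

/-- If points of `s` are `ε`-close whenever their images under `Φ` are `δ`-close, and the image of
`s` under `Φ` is totally bounded, then `s` is covered by finitely many `ε`-balls. -/
lemma exists_finite_cover_of_totallyBounded_image {α β : Type*} [PseudoMetricSpace α]
    [PseudoMetricSpace β] {s : Set α} {Φ : α → β} (hΦ : TotallyBounded (Φ '' s)) {δ ε : ℝ}
    (hδ : 0 < δ) (h : ∀ x ∈ s, ∀ y ∈ s, dist (Φ x) (Φ y) < δ → dist x y < ε) :
    ∃ t : Set α, t.Finite ∧ s ⊆ ⋃ y ∈ t, Metric.ball y ε := by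
  obtain ⟨t, hts, htf, hcover⟩ :=
    Set.exists_subset_image_finite_and.1 (Metric.finite_approx_of_totallyBounded hΦ δ hδ)
  refine ⟨t, htf, fun x hx => ?_⟩
  have hx' := hcover (Set.mem_image_of_mem Φ hx)
  simp only [Set.mem_iUnion, Set.mem_image, exists_prop, Metric.mem_ball] at hx' ⊢
  obtain ⟨_, ⟨y, hy, rfl⟩, hxy⟩ := hx'
  exact ⟨y, hy, h x hx y (hts hy) hxy⟩

lemma integrableOn_Icc_coeFn_Lp {B : Type*} [NormedAddCommGroup B] {T : ℝ} {p : ℝ≥0∞}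
    [hp1 : Fact (1 ≤ p)] (f : Lp B p (volume.restrict (Set.Icc (0 : ℝ) T))) :
    IntegrableOn f (Set.Icc 0 T) :=
  (Lp.memLp f).integrable hp1.out

lemma dist_lt_of_dist_stepAverage_le {B : Type*} [NormedAddCommGroup B] [NormedSpace ℝ B]
    [CompleteSpace B] {h T : ℝ} (hh : 0 < h) {N : ℕ} (hT : h * N = T) {p : ℝ≥0∞}
    [hp1 : Fact (1 ≤ p)] (hp : p ≠ ⊤) {ε η : ℝ} (hε : 0 < ε)
    (hη : (volume.restrict (Set.Icc 0 T)) Set.univ ^ p.toReal⁻¹ * ENNReal.ofReal η ≤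
      ENNReal.ofReal (ε / 4))
    {F : Set (Lp B p (volume.restrict (Set.Icc 0 T)))}
    (hF : ∀ f ∈ F, ∀ r, 0 < r → r < h → eLpNorm (fun t => f (t + r) - f t) p
      (volume.restrict (Set.Icc 0 (T - r))) ≤ ENNReal.ofReal (ε / 24))
    {f g : Lp B p (volume.restrict (Set.Icc 0 T))} (hf : f ∈ F) (hg : g ∈ F)
    (hfg : ∀ k < N, dist (⨍ s in middleThird h k, f s) (⨍ s in middleThird h k, g s) ≤ η) :
    dist f g < ε := by
  have happrox : ∀ f ∈ F, eLpNorm (⇑f - stepAverage h f) p (volume.restrict (Set.Icc 0 T)) ≤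
      ENNReal.ofReal (ε / 4) := by
    intro f hf
    refine (eLpNorm_sub_stepAverage_le (Lp.stronglyMeasurable f) hh hT
      (integrableOn_Icc_coeFn_Lp f) hp1.out hp (hF f hf)).trans_eq ?_
    rw [← ENNReal.ofReal_ofNat 6, ← ENNReal.ofReal_mul (by norm_num)]
    ring_nf
  have hmf := Lp.stronglyMeasurable f
  have hmg := Lp.stronglyMeasurable g
  have hsf := stronglyMeasurable_stepAverage h f
  have hsg := stronglyMeasurable_stepAverage h g
  have hstep : eLpNorm (stepAverage h f - stepAverage h g) p (volume.restrict (Set.Icc 0 T)) ≤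
      ENNReal.ofReal (ε / 4) := by
    refine le_trans (eLpNorm_le_of_ae_bound (C := η) ?_) hη
    have hIco : ∀ᵐ t ∂volume.restrict (Set.Icc 0 T), t ∈ Set.Ico 0 T := by
      rw [← Measure.restrict_congr_set Ico_ae_eq_Icc]
      exact ae_restrict_mem measurableSet_Ico
    filter_upwards [hIco] with t ht
    rw [Pi.sub_apply, ← dist_eq_norm]
    exact hfg _ (floor_div_lt hh (hT ▸ ht))
  rw [← ENNReal.ofReal_lt_ofReal_iff hε, ← edist_dist, Lp.edist_def]
  calc eLpNorm (⇑f - ⇑g) p (volume.restrict (Set.Icc 0 T))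
      = eLpNorm ((⇑f - stepAverage h f) + (stepAverage h f - stepAverage h g) -
          (⇑g - stepAverage h g)) p (volume.restrict (Set.Icc 0 T)) := by
        congr 1
        abel
    _ ≤ ENNReal.ofReal (ε / 4) + ENNReal.ofReal (ε / 4) + ENNReal.ofReal (ε / 4) :=
        (eLpNorm_sub_le ((hmf.sub hsf).add (hsf.sub hsg)).aestronglyMeasurable
          (hmg.sub hsg).aestronglyMeasurable hp1.out).trans
          (add_le_add ((eLpNorm_add_le (hmf.sub hsf).aestronglyMeasurable
            (hsf.sub hsg).aestronglyMeasurable hp1.out).trans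
            (add_le_add (happrox f hf) hstep)) (happrox g hg))
    _ < ENNReal.ofReal ε := by
        rw [← ENNReal.ofReal_add (by positivity) (by positivity),
          ← ENNReal.ofReal_add (by positivity) (by positivity),
          ENNReal.ofReal_lt_ofReal_iff hε]
        linarith

lemma totallyBounded_of_integrals_of_translations {B : Type*} [NormedAddCommGroup B]
    [NormedSpace ℝ B] [CompleteSpace B] {T : ℝ} (hT : 0 < T) {p : ℝ≥0∞} [Fact (1 ≤ p)]
    (hp : p ≠ ⊤) {F : Set (Lp B p (volume.restrict (Set.Icc (0 : ℝ) T)))}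
    (hint : ∀ t₁ t₂ : ℝ, 0 < t₁ → t₁ < t₂ → t₂ < T →
      IsCompact (closure ((fun f : Lp B p (volume.restrict (Set.Icc (0 : ℝ) T)) =>
        ∫ t in Set.Ioc t₁ t₂, f t) '' F)))
    (htrans : ∀ δ : ℝ, 0 < δ → ∃ h₀ : ℝ, 0 < h₀ ∧ ∀ h : ℝ, 0 < h → h < h₀ → ∀ f ∈ F,
      eLpNorm (fun t => f (t + h) - f t) p
        (volume.restrict (Set.Icc (0 : ℝ) (T - h))) ≤ ENNReal.ofReal δ) :
    TotallyBounded F := by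
  rw [Metric.totallyBounded_iff]
  intro ε hε
  obtain ⟨h₀, hh₀, hF⟩ := htrans (ε / 24) (by positivity)
  obtain ⟨N, hN⟩ := exists_nat_gt (T / h₀)
  have hN0 : (0 : ℝ) < N := lt_trans (by positivity) hN
  obtain ⟨h, hh, hhT, hhh₀⟩ : ∃ h : ℝ, 0 < h ∧ h * N = T ∧ h < h₀ := by
    refine ⟨T / N, by positivity, div_mul_cancel₀ _ hN0.ne', ?_⟩
    rw [div_lt_iff₀ hN0]
    rwa [div_lt_iff₀ hh₀, mul_comm] at hN
  set C : ℝ≥0∞ := (volume.restrict (Set.Icc 0 T)) Set.univ ^ p.toReal⁻¹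
  have hCtop : C ≠ ⊤ := ENNReal.rpow_ne_top_of_nonneg (by positivity) (measure_ne_top _ _)
  have hη : C * ENNReal.ofReal (ε / (4 * (C.toReal + 1))) ≤ ENNReal.ofReal (ε / 4) := by
    have hC0 : 0 ≤ C.toReal := ENNReal.toReal_nonneg
    rw [← ENNReal.ofReal_toReal hCtop, ← ENNReal.ofReal_mul hC0, ENNReal.toReal_ofReal hC0]
    refine ENNReal.ofReal_le_ofReal ?_
    rw [← mul_div_assoc, div_le_div_iff₀ (by positivity) (by positivity)]
    nlinarith
  refine exists_finite_cover_of_totallyBounded_image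
    (Φ := fun f (k : Fin N) => ⨍ s in middleThird h k, f s)
    (δ := ε / (4 * (C.toReal + 1))) ?_ (by positivity) ?_
  · refine ((isCompact_univ_pi fun k : Fin N => (hint (h * (k + 1 / 3)) (h * (k + 2 / 3))
      (by positivity) (by gcongr; norm_num) ?_).image
      (continuous_const_smul (volume.real (middleThird h k))⁻¹)).totallyBounded).subset ?_
    · have : (k : ℝ) + 1 ≤ N := by exact_mod_cast k.2
      nlinarith
    · rintro _ ⟨f, hf, rfl⟩ k -
      refine ⟨_, subset_closure (Set.mem_image_of_mem _ hf), ?_⟩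
      simp only [setAverage_eq, middleThird]
  · intro f hf g hg hfg
    refine dist_lt_of_dist_stepAverage_le hh hhT hp hε hη
      (fun f hf r hr0 hr => hF r hr0 (hr.trans hhh₀) f hf) hf hg fun k hk => ?_
    exact (dist_le_pi_dist _ _ (⟨k, hk⟩ : Fin N)).trans hfg.le

lemma continuous_setIntegral_Lp {B : Type*} [NormedAddCommGroup B] [NormedSpace ℝ B] {T : ℝ}
    {p : ℝ≥0∞} [hp1 : Fact (1 ≤ p)] {s : Set ℝ} (hs : s ⊆ Set.Icc 0 T) :
    Continuous fun f : Lp B p (volume.restrict (Set.Icc (0 : ℝ) T)) => ∫ t in s, f t := by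
  set C : ℝ≥0∞ := (volume.restrict (Set.Icc 0 T)) Set.univ ^ (1 / (1 : ℝ≥0∞).toReal - 1 / p.toReal)
  have hCtop : C ≠ ⊤ := by
    refine ENNReal.rpow_ne_top_of_nonneg ?_ (measure_ne_top _ _)
    rcases eq_or_ne p ⊤ with rfl | hp
    · simp
    · have : 1 ≤ p.toReal := by simpa using ENNReal.toReal_mono hp hp1.out
      simpa using inv_le_one_of_one_le₀ this
  refine LipschitzWith.continuous (K := C.toNNReal) fun f g => ?_
  rw [ENNReal.coe_toNNReal hCtop, edist_eq_enorm_sub,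
    ← integral_sub ((integrableOn_Icc_coeFn_Lp f).mono_set hs)
      ((integrableOn_Icc_coeFn_Lp g).mono_set hs), Lp.edist_def, mul_comm]
  calc ‖∫ t in s, (f t - g t)‖ₑ
      ≤ ∫⁻ t in s, ‖f t - g t‖ₑ := enorm_integral_le_lintegral_enorm _
    _ ≤ ∫⁻ t in Set.Icc 0 T, ‖f t - g t‖ₑ := lintegral_mono_set hs
    _ = eLpNorm (⇑f - ⇑g) 1 (volume.restrict (Set.Icc 0 T)) := by
        rw [eLpNorm_one_eq_lintegral_enorm]
        rfl
    _ ≤ _ := eLpNorm_le_eLpNorm_mul_rpow_measure_univ hp1.out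
        ((Lp.stronglyMeasurable f).sub (Lp.stronglyMeasurable g)).aestronglyMeasurable

/-- Extension by zero from a measurable set, as a map between `L^p` spaces. -/
noncomputable def extendByZeroLp {α B : Type*} [MeasurableSpace α] [NormedAddCommGroup B]
    {μ : Measure α} {p : ℝ≥0∞} {s : Set α} (hs : MeasurableSet s) (f : Lp B p (μ.restrict s)) :
    Lp B p μ :=
  ((memLp_indicator_iff_restrict hs).2 (Lp.memLp f)).toLp (s.indicator f)

lemma isometry_extendByZeroLp {α B : Type*} [MeasurableSpace α] [NormedAddCommGroup B]
    {μ : Measure α} {p : ℝ≥0∞} [Fact (1 ≤ p)] {s : Set α} (hs : MeasurableSet s) :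
    Isometry (extendByZeroLp (B := B) (μ := μ) (p := p) hs) := by
  intro f g
  rw [extendByZeroLp, extendByZeroLp, Lp.edist_toLp_toLp, ← Set.indicator_sub',
    eLpNorm_indicator_eq_eLpNorm_restrict hs, Lp.edist_def]

lemma eLpNorm_translate_sub_le {B : Type*} [NormedAddCommGroup B] {T h : ℝ} (hh : 0 < h)
    {p : ℝ≥0∞} [Fact (1 ≤ p)] (f : Lp B p (volume.restrict (Set.Icc (0 : ℝ) T))) :
    eLpNorm (fun t => f (t + h) - f t) p (volume.restrict (Set.Icc 0 (T - h))) ≤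
      edist (DomAddAct.mk h +ᵥ extendByZeroLp measurableSet_Icc f)
        (extendByZeroLp measurableSet_Icc f) := by
  rw [extendByZeroLp, DomAddAct.mk_vadd_toLp, Lp.edist_toLp_toLp,
    ← eLpNorm_indicator_eq_eLpNorm_restrict measurableSet_Icc]
  refine eLpNorm_mono_enorm fun t => ?_
  by_cases ht : t ∈ Set.Icc 0 (T - h)
  · have h1 : t ∈ Set.Icc 0 T := ⟨ht.1, by linarith [ht.2]⟩
    have h2 : h + t ∈ Set.Icc 0 T := ⟨by linarith [ht.1], by linarith [ht.2]⟩
    simp [Set.indicator_of_mem ht, Set.indicator_of_mem h1, Set.indicator_of_mem h2, add_comm t h]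
  · simp [Set.indicator_of_notMem ht]

lemma exists_forall_eLpNorm_translate_sub_le {B : Type*} [NormedAddCommGroup B] {T : ℝ}
    {p : ℝ≥0∞} [Fact (1 ≤ p)] (hp : p ≠ ⊤)
    {K : Set (Lp B p (volume.restrict (Set.Icc (0 : ℝ) T)))} (hK : IsCompact K) {δ : ℝ}
    (hδ : 0 < δ) :
    ∃ h₀ : ℝ, 0 < h₀ ∧ ∀ h : ℝ, 0 < h → h < h₀ → ∀ f ∈ K,
      eLpNorm (fun t => f (t + h) - f t) p
        (volume.restrict (Set.Icc (0 : ℝ) (T - h))) ≤ ENNReal.ofReal δ := by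
  have : Fact (p ≠ ⊤) := ⟨hp⟩
  let E := extendByZeroLp (B := B) (p := p) (μ := volume) (measurableSet_Icc (a := (0 : ℝ)) (b := T))
  have hE : Continuous E := (isometry_extendByZeroLp _).continuous
  have hcont : Continuous fun z : ℝ × Lp B p (volume.restrict (Set.Icc (0 : ℝ) T)) =>
      edist (DomAddAct.mk z.1 +ᵥ E z.2) (E z.2) :=
    ((DomAddAct.continuous_mk.comp continuous_fst).vadd (hE.comp continuous_snd)).edist
      (hE.comp continuous_snd)
  obtain ⟨u, v, hu, -, h0u, hKv, huv⟩ := generalized_tube_lemma (isCompact_singleton (x := (0 : ℝ)))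
    hK (isOpen_lt hcont (continuous_const (y := ENNReal.ofReal δ))) (by
      rintro ⟨r, f⟩ ⟨rfl, -⟩
      simpa using hδ)
  obtain ⟨h₀, hh₀, hball⟩ := Metric.isOpen_iff.1 hu 0 (h0u rfl)
  refine ⟨h₀, hh₀, fun h hh hlt f hf => (eLpNorm_translate_sub_le hh f).trans ?_⟩
  have hhu : h ∈ u := hball (by simpa [abs_of_pos hh] using hlt)
  exact (huv (Set.mk_mem_prod hhu (hKv hf)) : _ < _).le

/-- **Simon-type compactness criterion in `L^p([0,T];B)`.**
For a Banach space `B`, `0 < T < ∞` and `1 ≤ p < ∞`, a family `𝓕 ⊆ L^p([0,T];B)` is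
relatively compact if and only if
(i) for every `0 < t₁ < t₂ < T` the set of integrals `∫_{t₁}^{t₂} f(t) dt`, `f ∈ 𝓕`,
is relatively compact in `B`, and
(ii) `‖f(·+h) − f(·)‖_{L^p([0,T−h];B)} → 0` as `h → 0⁺` uniformly in `f ∈ 𝓕`. -/
theorem stmt_3 {B : Type*} [NormedAddCommGroup B] [NormedSpace ℝ B] [CompleteSpace B]
    (T : ℝ) (hT : 0 < T) (p : ℝ≥0∞) [hp1 : Fact (1 ≤ p)] (hp_top : p ≠ ⊤)
    (F : Set (Lp B p (volume.restrict (Set.Icc (0:ℝ) T)))) :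
    IsCompact (closure F) ↔
      ((∀ t₁ t₂ : ℝ, 0 < t₁ → t₁ < t₂ → t₂ < T →
          IsCompact (closure
            ((fun f : Lp B p (volume.restrict (Set.Icc (0:ℝ) T)) =>
              ∫ t in Set.Ioc t₁ t₂, f t) '' F))) ∧
        (∀ δ : ℝ, 0 < δ → ∃ h₀ : ℝ, 0 < h₀ ∧ ∀ h : ℝ, 0 < h → h < h₀ →
          ∀ f ∈ F,
            eLpNorm (fun t => f (t + h) - f t) p
              (volume.restrict (Set.Icc (0:ℝ) (T - h))) ≤ ENNReal.ofReal δ)) := by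
  constructor
  · intro hF
    refine ⟨fun t₁ t₂ h₁ _ h₂ => ?_, fun δ hδ => ?_⟩
    · refine (hF.image (continuous_setIntegral_Lp (s := Set.Ioc t₁ t₂) fun t ht =>
        ⟨h₁.le.trans ht.1.le, ht.2.trans h₂.le⟩)).closure_of_subset ?_
      exact Set.image_mono subset_closure
    · obtain ⟨h₀, hh₀, h⟩ := exists_forall_eLpNorm_translate_sub_le hp_top hF hδ
      exact ⟨h₀, hh₀, fun r hr0 hr f hf => h r hr0 hr f (subset_closure hf)⟩
  · rintro ⟨hint, htrans⟩
    exact isCompact_iff_totallyBounded_isComplete.2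
      ⟨(totallyBounded_of_integrals_of_translations hT hp_top hint htrans).closure,
        isClosed_closure.isComplete⟩
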